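/- For all integers n ≥ 1 and 0 ≤ m with 2m ≤ n, the space of highest weight vectors of weight n − 2m in the sl₂(ℂ)-module Cₙ, namely {v ∈ Cₙ : H·v = (n − 2m)·v and E·v = 0}, has complex dimension S(n,m) − S(n,m−1). Equivalently, the simple sl₂(ℂ)-module of highest weight n − 2m occurs in Cₙ with multiplicity S(n,m) − S(n,m−1). -/

import Mathlib

open scoped TensorProduct

noncomputable section

/-- V = ℂ². -/
abbrev V2 : Type := Fin 2 → ℂ

/-- The basis vectors e₁ = `bvec 0`, e₂ = `bvec 1` of V = ℂ². -/
def bvec (j : Fin 2) : V2 := Pi.single j 1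

/-- The matrix of H : H·e₁ = −e₁, H·e₂ = e₂. -/
def Hmat : Matrix (Fin 2) (Fin 2) ℂ := !![-1, 0; 0, 1]

/-- The matrix of E : E·e₁ = e₂, E·e₂ = 0. -/
def Emat : Matrix (Fin 2) (Fin 2) ℂ := !![0, 0; 1, 0]

/-- The matrix of F : F·e₂ = e₁, F·e₁ = 0. -/
def Fmat : Matrix (Fin 2) (Fin 2) ℂ := !![0, 1; 0, 0]

/-- The action of a matrix `g` on the `n`-fold tensor power of V = ℂ² by derivations:
`g·(v₁⊗⋯⊗vₙ) = Σᵢ v₁⊗⋯⊗(g·vᵢ)⊗⋯⊗vₙ`. -/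
def derivAction (n : ℕ) (g : Matrix (Fin 2) (Fin 2) ℂ) :
    (⨂[ℂ] _ : Fin n, V2) →ₗ[ℂ] ⨂[ℂ] _ : Fin n, V2 :=
  ∑ i : Fin n, PiTensorProduct.map
    (Function.update (fun _ : Fin n => (LinearMap.id : V2 →ₗ[ℂ] V2)) i g.mulVecLin)

/-- `Cyc n` : the subspace Cₙ ⊆ V^⊗n spanned by all `v₁⊗…⊗vₙ − v₂⊗…⊗vₙ⊗v₁`. -/
def Cyc (n : ℕ) : Submodule ℂ (⨂[ℂ] _ : Fin n, V2) :=
  Submodule.span ℂ {x | ∃ v : Fin n → V2,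
    x = PiTensorProduct.tprod ℂ v -
        PiTensorProduct.tprod ℂ (fun i => v (finRotate n i))}

/-- S(n,m) := Σ_{ℓ | n, n | ℓm} ((ℓ−1)/ℓ)·Σ_{k | gcd(ℓ, ℓm/n)} μ(k)·binom(ℓ/k, ℓm/(kn)),
where μ is the Möbius function. -/
def S (n m : ℕ) : ℚ :=
  ∑ ℓ ∈ n.divisors.filter (fun ℓ => n ∣ ℓ * m),
    (((ℓ : ℚ) - 1) / (ℓ : ℚ)) *
      ∑ k ∈ (Nat.gcd ℓ (ℓ * m / n)).divisors,
        ((ArithmeticFunction.moebius k : ℤ) : ℚ) * ((ℓ / k).choose (ℓ * m / (k * n)) : ℚ)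

/-- Words of length `n` in the letters `0, 1`, indexing the standard basis of `V^⊗n`. -/
abbrev Word (n : ℕ) : Type := Fin n → Fin 2

/-- The operation on words exchanging the two letters at position `i`. -/
def flipAt {n : ℕ} (i : Fin n) (w : Word n) : Word n := Function.update w i (w i).rev

lemma flipAt_same {n : ℕ} (i : Fin n) (w : Word n) : flipAt i w i = (w i).rev := by
  simp [flipAt]

lemma flipAt_of_ne {n : ℕ} {i j : Fin n} (h : j ≠ i) (w : Word n) : flipAt i w j = w j := by
  simp [flipAt, h]

lemma flipAt_involutive {n : ℕ} (i : Fin n) : Function.Involutive (flipAt i) := by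
  intro w
  simp [flipAt]

lemma flipAt_comm {n : ℕ} (i j : Fin n) (w : Word n) :
    flipAt i (flipAt j w) = flipAt j (flipAt i w) := by
  rcases eq_or_ne i j with rfl | h
  · rfl
  · simp only [flipAt, Function.update_of_ne h, Function.update_of_ne h.symm]
    exact Function.update_comm h.symm _ _ _

/-- The operator `f ↦ (w ↦ ∑ f (flipAt i w))` with the sum over the positions `i` of the letter `a`.
For `a = 1` these are the coordinates of `E`, and for `a = 0` those of `F`. -/
def flipSum (n : ℕ) (a : Fin 2) : (Word n → ℂ) →ₗ[ℂ] (Word n → ℂ) where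
  toFun f w := ∑ i, if w i = a then f (flipAt i w) else 0
  map_add' f g := by
    ext w
    simp only [Pi.add_apply, ← Finset.sum_add_distrib]
    exact Finset.sum_congr rfl fun i _ => by split_ifs <;> simp
  map_smul' c f := by
    ext w
    simp [Finset.mul_sum]

lemma flipSum_apply {n : ℕ} (a : Fin 2) (f : Word n → ℂ) (w : Word n) :
    flipSum n a f w = ∑ i, if w i = a then f (flipAt i w) else 0 := rfl

/-- The number of letters `0` in a word. -/
def zeros {n : ℕ} (w : Word n) : ℕ := (Finset.univ.filter fun i => w i = 0).card

lemma zeros_flipAt_of_eq_one {n : ℕ} {i : Fin n} {w : Word n} (h : w i = 1) :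
    zeros (flipAt i w) = zeros w + 1 := by
  have : (Finset.univ.filter fun j => flipAt i w j = 0)
      = insert i (Finset.univ.filter fun j => w j = 0) := by
    ext j
    rcases eq_or_ne j i with rfl | hj
    · simp [flipAt_same, h]
    · simp [flipAt_of_ne hj, hj]
  rw [zeros, this, Finset.card_insert_of_notMem (by simp [h]), zeros]

lemma zeros_flipAt_of_eq_zero {n : ℕ} {i : Fin n} {w : Word n} (h : w i = 0) :
    zeros w = zeros (flipAt i w) + 1 := by
  have := zeros_flipAt_of_eq_one (i := i) (w := flipAt i w) (by simp [flipAt_same, h])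
  rwa [flipAt_involutive] at this

lemma sum_sign_eq {n : ℕ} (w : Word n) :
    ∑ i, (if w i = 0 then (-1 : ℂ) else 1) = n - 2 * zeros w := by
  have h : ∀ i, (if w i = 0 then (-1 : ℂ) else 1) = 1 - 2 * (if w i = 0 then 1 else 0) := by
    intro i
    split_ifs <;> norm_num
  simp_rw [h, Finset.sum_sub_distrib, ← Finset.mul_sum, Finset.sum_boole]
  simp [zeros]

lemma flipSum_one_flipSum_zero {n : ℕ} (f : Word n → ℂ) (w : Word n) :
    flipSum n 1 (flipSum n 0 f) w
      = flipSum n 0 (flipSum n 1 f) w + ((n : ℂ) - 2 * zeros w) * f w := by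
  have h1 : flipSum n 1 (flipSum n 0 f) w = ∑ i, ∑ j,
      if w i = 1 ∧ flipAt i w j = 0 then f (flipAt j (flipAt i w)) else 0 := by
    rw [flipSum_apply]
    refine Finset.sum_congr rfl fun i _ => ?_
    simp only [flipSum_apply, ite_and]
    split_ifs <;> simp
  have h2 : flipSum n 0 (flipSum n 1 f) w = ∑ i, ∑ j,
      if w j = 0 ∧ flipAt j w i = 1 then f (flipAt j (flipAt i w)) else 0 := by
    rw [flipSum_apply, Finset.sum_comm]
    refine Finset.sum_congr rfl fun i _ => ?_
    simp only [flipSum_apply, ite_and, flipAt_comm i]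
    split_ifs <;> simp
  rw [h1, h2, ← sum_sign_eq, Finset.sum_mul, ← Finset.sum_add_distrib]
  refine Finset.sum_congr rfl fun i _ => ?_
  rw [← sub_eq_iff_eq_add', ← Finset.sum_sub_distrib, Finset.sum_eq_single i]
  · rw [flipAt_involutive, flipAt_same]
    have : w i = 0 ∨ w i = 1 := by omega
    rcases this with h | h <;> simp [h]
  · intro j _ hj
    rw [flipAt_of_ne hj, flipAt_of_ne hj.symm]
    simp only [and_comm, sub_self]
  · simp

lemma star_dotProduct_flipSum {n : ℕ} {a b : Fin 2} (hab : a.rev = b) (f g : Word n → ℂ) :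
    star f ⬝ᵥ flipSum n a g = star (flipSum n b f) ⬝ᵥ g := by
  simp only [dotProduct, flipSum_apply, Pi.star_apply, star_sum, Finset.mul_sum, Finset.sum_mul]
  rw [Finset.sum_comm]
  nth_rw 2 [Finset.sum_comm]
  refine Finset.sum_congr rfl fun i _ => ?_
  refine Fintype.sum_equiv (flipAt_involutive i).toPerm _ _ fun w => ?_
  simp only [Function.Involutive.coe_toPerm, flipAt_same, flipAt_involutive i w, ← hab,
    Fin.rev_inj]
  split_ifs <;> simp

lemma star_dotProduct_self {X : Type*} [Fintype X] (f : X → ℂ) :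
    star f ⬝ᵥ f = ((∑ x, Complex.normSq (f x) : ℝ) : ℂ) := by
  simp [dotProduct, Complex.normSq_eq_conj_mul_self]

/-- Functions on words supported on the words with `m` letters `0`. -/
def weightSpace (n m : ℕ) : Submodule ℂ (Word n → ℂ) where
  carrier := {f | ∀ w, zeros w ≠ m → f w = 0}
  add_mem' hf hg w hw := by simp [hf w hw, hg w hw]
  zero_mem' := by simp
  smul_mem' c f hf w hw := by simp [hf w hw]

lemma mem_weightSpace {n m : ℕ} {f : Word n → ℂ} :
    f ∈ weightSpace n m ↔ ∀ w, zeros w ≠ m → f w = 0 := Iff.rfl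

lemma flipSum_one_mem_weightSpace {n m : ℕ} {f : Word n → ℂ} (hf : f ∈ weightSpace n (m + 1)) :
    flipSum n 1 f ∈ weightSpace n m := by
  intro w hw
  rw [flipSum_apply]
  refine Finset.sum_eq_zero fun i _ => ?_
  split_ifs with h
  · exact hf _ (by rw [zeros_flipAt_of_eq_one h]; omega)
  · rfl

lemma flipSum_one_eq_zero {n : ℕ} {f : Word n → ℂ} (hf : f ∈ weightSpace n 0) :
    flipSum n 1 f = 0 := by
  ext w
  rw [flipSum_apply]
  refine Finset.sum_eq_zero fun i _ => ?_
  split_ifs with h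
  · exact hf _ (by rw [zeros_flipAt_of_eq_one h]; omega)
  · rfl

lemma flipSum_zero_mem_weightSpace {n m : ℕ} {f : Word n → ℂ} (hf : f ∈ weightSpace n m) :
    flipSum n 0 f ∈ weightSpace n (m + 1) := by
  intro w hw
  rw [flipSum_apply]
  refine Finset.sum_eq_zero fun i _ => ?_
  split_ifs with h
  · exact hf _ (by have := zeros_flipAt_of_eq_zero h; omega)
  · rfl

lemma eq_zero_of_flipSum_flipSum_eq_zero {n m : ℕ} (hm : 2 * m < n) {f : Word n → ℂ}
    (hf : f ∈ weightSpace n m) (h : flipSum n 1 (flipSum n 0 f) = 0) : f = 0 := by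
  have h1 : flipSum n 0 (flipSum n 1 f) + ((n : ℂ) - 2 * m) • f = 0 := by
    ext w
    have := flipSum_one_flipSum_zero f w
    rw [h] at this
    rw [this]
    by_cases hw : zeros w = m
    · simp [hw]
    · simp [hf w hw]
  have h2 := congrArg (fun g => star f ⬝ᵥ g) h1
  simp only [dotProduct_add, dotProduct_smul, dotProduct_zero,
    star_dotProduct_flipSum (a := 0) (b := 1) rfl, star_dotProduct_self, smul_eq_mul] at h2
  have h3 : (∑ w, Complex.normSq (flipSum n 1 f w))
      + ((n : ℝ) - 2 * m) * ∑ w, Complex.normSq (f w) = 0 := by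
    exact_mod_cast h2
  have h4 : 0 ≤ ∑ w, Complex.normSq (flipSum n 1 f w) :=
    Finset.sum_nonneg fun _ _ => Complex.normSq_nonneg _
  have h5 : 0 ≤ ∑ w, Complex.normSq (f w) :=
    Finset.sum_nonneg fun _ _ => Complex.normSq_nonneg _
  have h6 : (0 : ℝ) < (n : ℝ) - 2 * m := by
    have : ((2 * m : ℕ) : ℝ) < n := by exact_mod_cast hm
    push_cast at this
    linarith
  have h7 : ∑ w, Complex.normSq (f w) = 0 := by
    nlinarith
  rw [Finset.sum_eq_zero_iff_of_nonneg fun _ _ => Complex.normSq_nonneg _] at h7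
  ext w
  simpa using h7 w (Finset.mem_univ w)

/-- The cyclic rotation of words. -/
def rotWord (n : ℕ) : Equiv.Perm (Word n) := Equiv.arrowCongr (finRotate n) (Equiv.refl _)

lemma rotWord_apply {n : ℕ} (w : Word n) (i : Fin n) :
    rotWord n w i = w ((finRotate n).symm i) := rfl

lemma rotWord_apply_finRotate {n : ℕ} (w : Word n) (i : Fin n) :
    rotWord n w (finRotate n i) = w i := by
  rw [rotWord_apply, Equiv.symm_apply_apply]

lemma zeros_rotWord {n : ℕ} (w : Word n) : zeros (rotWord n w) = zeros w := by
  refine Finset.card_equiv (finRotate n).symm fun i => ?_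
  simp [rotWord_apply]

lemma rotWord_flipAt {n : ℕ} (i : Fin n) (w : Word n) :
    rotWord n (flipAt i w) = flipAt (finRotate n i) (rotWord n w) := by
  ext j
  obtain ⟨j, rfl⟩ := (finRotate n).surjective j
  rw [rotWord_apply_finRotate]
  rcases eq_or_ne j i with rfl | h
  · rw [flipAt_same, flipAt_same, rotWord_apply_finRotate]
  · rw [flipAt_of_ne h, flipAt_of_ne (by simpa using h), rotWord_apply_finRotate]

/-- The operator `f ↦ f - f ∘ σ`. -/
def idSubComp {X : Type*} (σ : Equiv.Perm X) : (X → ℂ) →ₗ[ℂ] (X → ℂ) :=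
  LinearMap.id - LinearMap.funLeft ℂ ℂ σ

lemma idSubComp_apply {X : Type*} (σ : Equiv.Perm X) (f : X → ℂ) (x : X) :
    idSubComp σ f x = f x - f (σ x) := rfl

lemma flipSum_idSubComp {n : ℕ} (a : Fin 2) (f : Word n → ℂ) :
    flipSum n a (idSubComp (rotWord n) f) = idSubComp (rotWord n) (flipSum n a f) := by
  have : flipSum n a (f ∘ rotWord n) = flipSum n a f ∘ rotWord n := by
    ext w
    simp only [Function.comp_apply, flipSum_apply]
    refine Fintype.sum_equiv (finRotate n) _ _ fun i => ?_
    rw [rotWord_apply_finRotate, rotWord_flipAt]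
  change flipSum n a (f - f ∘ rotWord n) = _
  rw [map_sub, this]
  rfl

/-- The weight spaces of `Cₙ` in coordinates. -/
def cycWeight (n m : ℕ) : Submodule ℂ (Word n → ℂ) :=
  LinearMap.range (idSubComp (rotWord n)) ⊓ weightSpace n m

lemma flipSum_mem_range {n : ℕ} (a : Fin 2) {f : Word n → ℂ}
    (hf : f ∈ LinearMap.range (idSubComp (rotWord n))) :
    flipSum n a f ∈ LinearMap.range (idSubComp (rotWord n)) := by
  obtain ⟨g, rfl⟩ := hf
  exact ⟨flipSum n a g, (flipSum_idSubComp a g).symm⟩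

lemma finrank_cycWeight_inf_ker_zero (n : ℕ) :
    Module.finrank ℂ ↥(cycWeight n 0 ⊓ LinearMap.ker (flipSum n 1))
      = Module.finrank ℂ (cycWeight n 0) := by
  rw [inf_eq_left.mpr]
  exact fun f hf => flipSum_one_eq_zero hf.2

lemma finrank_cycWeight_inf_ker_succ {n m : ℕ} (hm : 2 * m < n) :
    Module.finrank ℂ ↥(cycWeight n (m + 1) ⊓ LinearMap.ker (flipSum n 1))
      + Module.finrank ℂ (cycWeight n m) = Module.finrank ℂ (cycWeight n (m + 1)) := by
  have hE : ∀ f ∈ cycWeight n (m + 1), flipSum n 1 f ∈ cycWeight n m := fun f hf =>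
    ⟨flipSum_mem_range 1 hf.1, flipSum_one_mem_weightSpace hf.2⟩
  have hF : ∀ f ∈ cycWeight n m, flipSum n 0 f ∈ cycWeight n (m + 1) := fun f hf =>
    ⟨flipSum_mem_range 0 hf.1, flipSum_zero_mem_weightSpace hf.2⟩
  let e := (flipSum n 1).restrict hE
  let f := (flipSum n 0).restrict hF
  have hinj : Function.Injective (e ∘ₗ f) := by
    rw [injective_iff_map_eq_zero]
    intro x hx
    exact Subtype.ext (eq_zero_of_flipSum_flipSum_eq_zero hm x.2.2 (congrArg Subtype.val hx))
  have hsurj : Function.Surjective e :=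
    Function.Surjective.of_comp (g := f) (LinearMap.injective_iff_surjective.mp hinj)
  have hker : Module.finrank ℂ (LinearMap.ker e)
      = Module.finrank ℂ ↥(cycWeight n (m + 1) ⊓ LinearMap.ker (flipSum n 1)) := by
    rw [LinearMap.ker_restrict, ← Submodule.map_comap_subtype]
    exact (Submodule.equivMapOfInjective _ (Submodule.injective_subtype _) _).finrank_eq
  rw [← hker, ← LinearMap.finrank_range_add_finrank_ker e, LinearMap.range_eq_top.mpr hsurj,
    finrank_top, add_comm]

lemma finrank_ker_idSubComp {X : Type*} [Fintype X] (σ : Equiv.Perm X) :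
    (Module.finrank ℂ (LinearMap.ker (idSubComp σ)) : ℚ)
      = ∑ x, (1 : ℚ) / Function.minimalPeriod σ x := by
  classical
  let Q := MulAction.orbitRel.Quotient (Subgroup.zpowers σ) X
  have hmk : ∀ x : X, (Quotient.mk'' (σ x) : Q) = Quotient.mk'' x := fun x =>
    Quotient.sound' ⟨⟨σ, Subgroup.mem_zpowers σ⟩, rfl⟩
  have hrange : LinearMap.ker (idSubComp σ)
      = LinearMap.range (LinearMap.funLeft ℂ ℂ (Quotient.mk'' : X → Q)) := by
    ext f
    constructor
    · intro hf
      have hσ : ∀ x, f (σ x) = f x := fun x =>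
        (sub_eq_zero.mp (congrFun (LinearMap.mem_ker.mp hf) x)).symm
      have hinv : ∀ g ∈ Subgroup.zpowers σ, ∀ x, f (g x) = f x := by
        rintro _ ⟨k, rfl⟩
        induction k using Int.induction_on with
        | zero => simp
        | succ k ih =>
          intro x
          simp only [zpow_add_one, Equiv.Perm.mul_apply] at ih ⊢
          rw [ih, hσ]
        | pred k ih =>
          intro x
          simp only [zpow_sub_one, Equiv.Perm.mul_apply] at ih ⊢
          rw [ih, ← hσ, ← Equiv.Perm.mul_apply, mul_inv_cancel, Equiv.Perm.one_apply]
      refine ⟨Quotient.lift f ?_, rfl⟩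
      rintro x y ⟨g, rfl⟩
      exact hinv g g.2 y
    · rintro ⟨g, rfl⟩
      rw [LinearMap.mem_ker]
      ext x
      simp [idSubComp_apply, LinearMap.funLeft_apply, hmk]
  rw [hrange, LinearMap.finrank_range_of_inj
    (LinearMap.funLeft_injective_of_surjective ℂ ℂ _ Quotient.mk''_surjective),
    Module.finrank_fintype_fun_eq_card]
  rw [← Finset.sum_fiberwise Finset.univ (Quotient.mk'' : X → Q), Fintype.card,
    Finset.card_eq_sum_ones]
  push_cast
  refine Finset.sum_congr rfl fun q _ => ?_
  induction q using Quotient.inductionOn' with | h x => ?_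
  have hcard : ∀ y ∈ Finset.univ.filter fun y => (Quotient.mk'' y : Q) = Quotient.mk'' x,
      Function.minimalPeriod σ y
        = (Finset.univ.filter fun y => (Quotient.mk'' y : Q) = Quotient.mk'' x).card := by
    intro y hy
    have h1 := MulAction.minimalPeriod_eq_card σ y
    simp only [Equiv.Perm.smul_def] at h1
    rw [h1, ← Set.toFinset_card]
    congr 1
    ext z
    rw [Set.mem_toFinset, Finset.mem_filter, ← (Finset.mem_filter.mp hy).2]
    simp only [Finset.mem_univ, true_and]
    exact ⟨fun h => Quotient.sound' h, fun h => Quotient.exact' h⟩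
  rw [Finset.sum_congr rfl fun y hy => by rw [hcard y hy], Finset.sum_const, nsmul_eq_mul,
    mul_one_div_cancel]
  exact Nat.cast_ne_zero.mpr (Finset.card_ne_zero_of_mem (a := x) (by simp))

/-- Each orbit of `σ` of size `ℓ` contributes `ℓ - 1` to the rank of `f ↦ f - f ∘ σ`. -/
lemma finrank_range_idSubComp {X : Type*} [Fintype X] (σ : Equiv.Perm X) :
    (Module.finrank ℂ (LinearMap.range (idSubComp σ)) : ℚ)
      = ∑ x, (1 - (1 : ℚ) / Function.minimalPeriod σ x) := by
  have := LinearMap.finrank_range_add_finrank_ker (idSubComp σ)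
  rw [Finset.sum_sub_distrib, ← finrank_ker_idSubComp, eq_sub_iff_add_eq]
  rw [Module.finrank_fintype_fun_eq_card] at this
  simp [← this]

lemma finrank_cycWeight (n m : ℕ) :
    (Module.finrank ℂ (cycWeight n m) : ℚ)
      = ∑ w : Word n with zeros w = m, (1 - (1 : ℚ) / Function.minimalPeriod (rotWord n) w) := by
  let τ : Equiv.Perm {w : Word n // zeros w = m} :=
    (rotWord n).subtypePerm fun w => by rw [zeros_rotWord]
  let j : ({w : Word n // zeros w = m} → ℂ) →ₗ[ℂ] (Word n → ℂ) :=
    Function.ExtendByZero.linearMap ℂ Subtype.val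
  have hj : ∀ g (x : {w : Word n // zeros w = m}), j g x = g x := fun g x =>
    Subtype.val_injective.extend_apply g 0 x
  have hj' : ∀ g (w : Word n), zeros w ≠ m → j g w = 0 := fun g w hw =>
    Function.extend_apply' (f := Subtype.val) g (0 : Word n → ℂ) w (fun ⟨x, hx⟩ => hw (hx ▸ x.2))
  have hcomm : ∀ g, j (idSubComp τ g) = idSubComp (rotWord n) (j g) := by
    intro g
    ext w
    by_cases hw : zeros w = m
    · have h1 := hj (idSubComp τ g) ⟨w, hw⟩
      have h2 := hj g ⟨w, hw⟩
      have h3 := hj g (τ ⟨w, hw⟩)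
      rw [idSubComp_apply, ← h2, ← h3] at h1
      exact h1
    · rw [idSubComp_apply, hj' _ _ hw, hj' _ _ hw, hj' _ _ (by rwa [zeros_rotWord]), sub_zero]
  have hmap : cycWeight n m = (LinearMap.range (idSubComp τ)).map j := by
    ext f
    constructor
    · rintro ⟨⟨g, rfl⟩, hf⟩
      refine ⟨idSubComp τ fun x => g x, ⟨_, rfl⟩, ?_⟩
      ext w
      by_cases hw : zeros w = m
      · exact hj _ ⟨w, hw⟩
      · rw [hj' _ _ hw, hf w hw]
    · rintro ⟨_, ⟨g, rfl⟩, rfl⟩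
      exact ⟨⟨j g, (hcomm g).symm⟩, hj' _⟩
  have hinj : Function.Injective j := fun g g' h => by
    ext x
    rw [← hj g, ← hj g', h]
  rw [hmap, ← (Submodule.equivMapOfInjective j hinj _).finrank_eq, finrank_range_idSubComp,
    Finset.sum_subtype (p := fun w => zeros w = m) _ (by simp)]
  refine Finset.sum_congr rfl fun x _ => ?_
  have : Function.minimalPeriod τ x = Function.minimalPeriod (rotWord n) x := by
    rw [Function.minimalPeriod_eq_minimalPeriod_iff]
    intro k
    have : ((τ^[k] x : {w : Word n // zeros w = m}) : Word n) = (rotWord n)^[k] x :=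
      Function.Semiconj.iterate_right (f := Subtype.val) (fun _ => rfl) k x
    rw [Function.IsPeriodicPt, Function.IsPeriodicPt, Function.IsFixedPt, Function.IsFixedPt,
      ← this, Subtype.ext_iff]
  rw [this]

/-- The standard basis of `V^⊗n`, indexed by words. -/
def wordBasis (n : ℕ) : Module.Basis (Word n) ℂ (⨂[ℂ] _ : Fin n, V2) :=
  Basis.piTensorProduct fun _ => Pi.basisFun ℂ (Fin 2)

lemma wordBasis_apply {n : ℕ} (w : Word n) :
    wordBasis n w = PiTensorProduct.tprod ℂ fun i => (Pi.single (w i) 1 : V2) := by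
  simp [wordBasis]

lemma map_update_wordBasis {n : ℕ} (i : Fin n) (g : V2 →ₗ[ℂ] V2) (w : Word n) :
    PiTensorProduct.map (Function.update (fun _ : Fin n => (LinearMap.id : V2 →ₗ[ℂ] V2)) i g)
        (wordBasis n w)
      = PiTensorProduct.tprod ℂ
        (Function.update (fun j => (Pi.single (w j) 1 : V2)) i (g (Pi.single (w i) 1))) := by
  rw [wordBasis_apply, PiTensorProduct.map_tprod]
  congr 1
  ext1 j
  rcases eq_or_ne j i with rfl | h
  · simp
  · simp [h]

lemma Emat_mulVec_single (a : Fin 2) :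
    Emat.mulVecLin (Pi.single a 1) = if a = 0 then Pi.single a.rev 1 else 0 := by
  fin_cases a <;> ext j <;> fin_cases j <;> simp [Emat]

lemma Hmat_mulVec_single (a : Fin 2) :
    Hmat.mulVecLin (Pi.single a 1) = (if a = 0 then (-1 : ℂ) else 1) • Pi.single a 1 := by
  fin_cases a <;> ext j <;> fin_cases j <;> simp [Hmat]

lemma derivAction_Hmat_wordBasis {n : ℕ} (w : Word n) :
    derivAction n Hmat (wordBasis n w) = ((n : ℂ) - 2 * zeros w) • wordBasis n w := by
  rw [derivAction, LinearMap.sum_apply, ← sum_sign_eq, Finset.sum_smul]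
  refine Finset.sum_congr rfl fun i _ => ?_
  rw [map_update_wordBasis, Hmat_mulVec_single, MultilinearMap.map_update_smul,
    Function.update_eq_self, wordBasis_apply]

lemma derivAction_Emat_wordBasis {n : ℕ} (w : Word n) :
    derivAction n Emat (wordBasis n w)
      = ∑ i, if w i = 0 then wordBasis n (flipAt i w) else 0 := by
  rw [derivAction, LinearMap.sum_apply]
  refine Finset.sum_congr rfl fun i _ => ?_
  rw [map_update_wordBasis, Emat_mulVec_single]
  split_ifs with h
  · rw [wordBasis_apply]
    congr 1
    ext1 j
    rcases eq_or_ne j i with rfl | hj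
    · simp [flipAt_same]
    · simp [flipAt_of_ne hj, hj]
  · exact MultilinearMap.map_update_zero _ _ _

lemma equivFun_derivAction_Emat {n : ℕ} (x : ⨂[ℂ] _ : Fin n, V2) :
    (wordBasis n).equivFun (derivAction n Emat x) = flipSum n 1 ((wordBasis n).equivFun x) := by
  have : (wordBasis n).equivFun.toLinearMap ∘ₗ derivAction n Emat
      = flipSum n 1 ∘ₗ (wordBasis n).equivFun.toLinearMap := by
    refine (wordBasis n).ext fun w => ?_
    ext u
    simp only [LinearMap.comp_apply, LinearEquiv.coe_coe, derivAction_Emat_wordBasis, map_sum,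
      Finset.sum_apply, flipSum_apply]
    refine Finset.sum_congr rfl fun i _ => ?_
    have key : u = flipAt i w ↔ flipAt i u = w := by
      rw [← (flipAt_involutive i).injective.eq_iff, flipAt_involutive i w]
    by_cases hu : flipAt i u = w
    · subst hu
      have : ∀ a : Fin 2, a.rev = 0 ↔ a = 1 := by decide
      simp [flipAt_same, flipAt_involutive i u, this, apply_ite, ite_apply]
    · have : u ≠ flipAt i w := fun h => hu (key.mp h)
      split_ifs <;> simp [Module.Basis.equivFun_self, Ne.symm this, Ne.symm hu]
  exact LinearMap.congr_fun this x

lemma equivFun_derivAction_Hmat {n : ℕ} (x : ⨂[ℂ] _ : Fin n, V2) (w : Word n) :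
    (wordBasis n).equivFun (derivAction n Hmat x) w
      = ((n : ℂ) - 2 * zeros w) * (wordBasis n).equivFun x w := by
  have : LinearMap.proj w ∘ₗ (wordBasis n).equivFun.toLinearMap ∘ₗ derivAction n Hmat
      = ((n : ℂ) - 2 * zeros w) • LinearMap.proj w ∘ₗ (wordBasis n).equivFun.toLinearMap := by
    refine (wordBasis n).ext fun u => ?_
    rcases eq_or_ne u w with rfl | h
    · simp [derivAction_Hmat_wordBasis]
    · simp [derivAction_Hmat_wordBasis, Module.Basis.equivFun_self, h]
  exact LinearMap.congr_fun this x

lemma Cyc_eq_range (n : ℕ) :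
    Cyc n = LinearMap.range (LinearMap.id
      - (PiTensorProduct.reindex ℂ (fun _ : Fin n => V2) (finRotate n).symm).toLinearMap) := by
  rw [LinearMap.range_eq_map, ← PiTensorProduct.span_tprod_eq_top, Submodule.map_span, Cyc]
  congr 1
  ext x
  constructor
  · rintro ⟨v, rfl⟩
    refine ⟨_, ⟨v, rfl⟩, ?_⟩
    simp [PiTensorProduct.reindex_tprod]
  · rintro ⟨_, ⟨v, rfl⟩, rfl⟩
    refine ⟨v, ?_⟩
    simp [PiTensorProduct.reindex_tprod]

lemma equivFun_reindex {n : ℕ} (x : ⨂[ℂ] _ : Fin n, V2) (u : Word n) :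
    (wordBasis n).equivFun
        (PiTensorProduct.reindex ℂ (fun _ : Fin n => V2) (finRotate n).symm x) u
      = (wordBasis n).equivFun x (rotWord n u) := by
  have hb : ∀ w, PiTensorProduct.reindex ℂ (fun _ : Fin n => V2) (finRotate n).symm
      (wordBasis n w) = wordBasis n ((rotWord n).symm w) := by
    intro w
    rw [wordBasis_apply, wordBasis_apply, PiTensorProduct.reindex_tprod]
    rfl
  have : LinearMap.proj u ∘ₗ (wordBasis n).equivFun.toLinearMap ∘ₗ
        (PiTensorProduct.reindex ℂ (fun _ : Fin n => V2) (finRotate n).symm).toLinearMap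
      = LinearMap.proj (rotWord n u) ∘ₗ (wordBasis n).equivFun.toLinearMap := by
    refine (wordBasis n).ext fun w => ?_
    simp only [LinearMap.comp_apply, LinearEquiv.coe_coe, hb, LinearMap.proj_apply,
      Module.Basis.equivFun_self, Equiv.symm_apply_eq]
  exact LinearMap.congr_fun this x

lemma equivFun_mem_range_iff {n : ℕ} (x : ⨂[ℂ] _ : Fin n, V2) :
    (wordBasis n).equivFun x ∈ LinearMap.range (idSubComp (rotWord n)) ↔ x ∈ Cyc n := by
  have h : ∀ y, (wordBasis n).equivFun
      (y - PiTensorProduct.reindex ℂ (fun _ : Fin n => V2) (finRotate n).symm y)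
      = idSubComp (rotWord n) ((wordBasis n).equivFun y) := by
    intro y
    ext u
    rw [idSubComp_apply, ← equivFun_reindex]
    simp
  rw [Cyc_eq_range]
  constructor
  · rintro ⟨f, hf⟩
    refine ⟨(wordBasis n).equivFun.symm f, (wordBasis n).equivFun.injective ?_⟩
    refine (h ((wordBasis n).equivFun.symm f)).trans ?_
    rw [LinearEquiv.apply_symm_apply, hf]
  · rintro ⟨y, rfl⟩
    exact ⟨_, (h y).symm⟩

lemma equivFun_mem_weightSpace_iff {n m : ℕ} (x : ⨂[ℂ] _ : Fin n, V2) :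
    (wordBasis n).equivFun x ∈ weightSpace n m
      ↔ x ∈ LinearMap.ker (derivAction n Hmat - ((n : ℂ) - 2 * m) • LinearMap.id) := by
  rw [LinearMap.mem_ker, ← (wordBasis n).equivFun.map_eq_zero_iff, funext_iff, mem_weightSpace]
  refine forall_congr' fun w => ?_
  have : (wordBasis n).equivFun (derivAction n Hmat x - ((n : ℂ) - 2 * m) • x) w
      = 2 * ((m : ℂ) - zeros w) * (wordBasis n).equivFun x w := by
    rw [map_sub, Pi.sub_apply, equivFun_derivAction_Hmat, map_smul, Pi.smul_apply, smul_eq_mul]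
    ring
  rw [LinearMap.sub_apply, LinearMap.smul_apply, LinearMap.id_apply]
  rw [this, Pi.zero_apply, mul_eq_zero, mul_eq_zero, sub_eq_zero, Nat.cast_inj]
  simp only [OfNat.ofNat_ne_zero, false_or]
  tauto

lemma finrank_highestWeight (n m : ℕ) :
    Module.finrank ℂ
      ↥(Cyc n ⊓ LinearMap.ker (derivAction n Hmat - ((n : ℂ) - 2 * m) • LinearMap.id)
              ⊓ LinearMap.ker (derivAction n Emat))
      = Module.finrank ℂ ↥(cycWeight n m ⊓ LinearMap.ker (flipSum n 1)) := by
  suffices h : (Cyc n ⊓ LinearMap.ker (derivAction n Hmat - ((n : ℂ) - 2 * m) • LinearMap.id)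
      ⊓ LinearMap.ker (derivAction n Emat)).map (wordBasis n).equivFun.toLinearMap
      = cycWeight n m ⊓ LinearMap.ker (flipSum n 1) by
    rw [← h, LinearEquiv.finrank_map_eq]
  ext f
  obtain ⟨x, rfl⟩ := (wordBasis n).equivFun.surjective f
  have hE : x ∈ LinearMap.ker (derivAction n Emat)
      ↔ (wordBasis n).equivFun x ∈ LinearMap.ker (flipSum n 1) := by
    rw [LinearMap.mem_ker, LinearMap.mem_ker, ← equivFun_derivAction_Emat,
      LinearEquiv.map_eq_zero_iff]
  rw [cycWeight, Submodule.mem_inf, Submodule.mem_inf, equivFun_mem_range_iff,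
    equivFun_mem_weightSpace_iff, ← hE, ← Submodule.mem_inf, ← Submodule.mem_inf]
  exact (wordBasis n).equivFun.injective.mem_set_image

lemma card_filter_zeros_eq (d j : ℕ) :
    (Finset.univ.filter fun u : Word d => zeros u = j).card = d.choose j := by
  conv_rhs => rw [← Fintype.card_fin d, ← Finset.card_univ, ← Finset.card_powersetCard]
  refine Finset.card_bij (fun u _ => Finset.univ.filter fun i => u i = 0) ?_ ?_ ?_
  · intro u hu
    simpa [zeros] using (Finset.mem_filter.mp hu).2
  · intro u _ v _ h
    ext1 i
    have hi : u i = 0 ↔ v i = 0 := by simpa using congrArg (i ∈ ·) h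
    omega
  · intro s hs
    have h : (Finset.univ.filter fun i => (if i ∈ s then (0 : Fin 2) else 1) = 0) = s := by
      ext i
      simp
    refine ⟨fun i => if i ∈ s then 0 else 1, ?_, h⟩
    rw [Finset.mem_filter, zeros, h]
    simpa using hs

lemma val_finRotate_iterate {n : ℕ} (d : ℕ) (i : Fin n) :
    ((finRotate n)^[d] i : ℕ) = (i + d) % n := by
  induction d with
  | zero => simp [Nat.mod_eq_of_lt i.2]
  | succ d ih =>
    have : NeZero n := ⟨i.pos.ne'⟩
    rw [Function.iterate_succ_apply', finRotate_apply, Fin.val_add, ih, Fin.val_one', ← Nat.add_mod,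
      add_assoc]

lemma isPeriodicPt_rotWord_iff {n d : ℕ} {w : Word n} :
    Function.IsPeriodicPt (rotWord n) d w ↔ ∀ i, w ((finRotate n)^[d] i) = w i := by
  have h : ∀ i, (rotWord n)^[d] w ((finRotate n)^[d] i) = w i := by
    induction d with
    | zero => simp
    | succ d ih =>
      intro i
      rw [Function.iterate_succ_apply', Function.iterate_succ_apply', rotWord_apply_finRotate, ih]
  rw [Function.IsPeriodicPt, Function.IsFixedPt, funext_iff,
    ((finRotate n).surjective.iterate d).forall]
  simp only [h, eq_comm]

/-- The word of length `q * d` obtained by repeating a word of length `d`. -/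
def repeatWord (q : ℕ) {d : ℕ} (u : Word d) : Word (q * d) :=
  fun i => u (finProdFinEquiv.symm i).2

lemma zeros_repeatWord (q : ℕ) {d : ℕ} (u : Word d) : zeros (repeatWord q u) = q * zeros u := by
  rw [zeros, zeros, Finset.card_filter, Finset.card_filter,
    ← Equiv.sum_comp finProdFinEquiv, Fintype.sum_prod_type]
  simp [repeatWord]

lemma isPeriodicPt_repeatWord (q : ℕ) {d : ℕ} (u : Word d) :
    Function.IsPeriodicPt (rotWord (q * d)) d (repeatWord q u) := by
  rw [isPeriodicPt_rotWord_iff]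
  intro i
  refine congrArg u (Fin.ext ?_)
  simp only [finProdFinEquiv_symm_apply, Fin.modNat, val_finRotate_iterate]
  rw [Nat.mod_mul_left_mod, Nat.add_mod_right]

lemma exists_repeatWord_eq {q d : ℕ} (hq : 0 < q) {w : Word (q * d)}
    (hw : Function.IsPeriodicPt (rotWord (q * d)) d w) : ∃ u, repeatWord q u = w := by
  rw [isPeriodicPt_rotWord_iff] at hw
  refine ⟨fun y => w (finProdFinEquiv (⟨0, hq⟩, y)), ?_⟩
  ext1 i
  obtain ⟨⟨⟨x, hx⟩, y⟩, rfl⟩ := finProdFinEquiv.surjective i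
  simp only [repeatWord, Equiv.symm_apply_apply]
  induction x with
  | zero => rfl
  | succ x ih =>
    rw [ih (by omega), ← hw]
    congr 1
    ext1
    have hlt := (finProdFinEquiv (⟨x + 1, hx⟩, y)).2
    rw [val_finRotate_iterate]
    rw [finProdFinEquiv_apply_val] at hlt ⊢
    rw [finProdFinEquiv_apply_val]
    simp only [mul_add, mul_one, ← add_assoc] at hlt ⊢
    exact Nat.mod_eq_of_lt hlt

/-- The number of words with `m` letters `0` fixed by the `d`-th power of the rotation. -/
lemma card_isPeriodicPt {n d m : ℕ} (hn : 0 < n) (hd : d ∣ n) :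
    (Finset.univ.filter fun w : Word n =>
        zeros w = m ∧ Function.IsPeriodicPt (rotWord n) d w).card
      = if n ∣ d * m then d.choose (d * m / n) else 0 := by
  obtain ⟨q, rfl⟩ := hd
  rw [mul_comm d q] at hn ⊢
  have hq : 0 < q := Nat.pos_of_mul_pos_right hn
  have hd : 0 < d := Nat.pos_of_mul_pos_left hn
  have h : (Finset.univ.filter fun w : Word (q * d) =>
      zeros w = m ∧ Function.IsPeriodicPt (rotWord (q * d)) d w).card
      = (Finset.univ.filter fun u : Word d => q * zeros u = m).card := by
    symm
    refine Finset.card_bij (fun u _ => repeatWord q u) ?_ ?_ ?_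
    · intro u hu
      simpa [zeros_repeatWord, isPeriodicPt_repeatWord] using hu
    · intro u _ v _ huv
      ext1 y
      have := congrFun huv (finProdFinEquiv (⟨0, hq⟩, y))
      simpa [repeatWord] using this
    · intro w hw
      simp only [Finset.mem_filter, Finset.mem_univ, true_and] at hw
      obtain ⟨u, rfl⟩ := exists_repeatWord_eq hq hw.2
      exact ⟨u, by simpa [zeros_repeatWord] using hw.1, rfl⟩
  rw [h, mul_comm q d, Nat.mul_div_mul_left _ _ hd]
  simp only [Nat.mul_dvd_mul_iff_left hd]
  split_ifs with hm
  · obtain ⟨j, rfl⟩ := hm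
    rw [Nat.mul_div_cancel_left _ hq, ← card_filter_zeros_eq]
    simp only [Nat.mul_right_inj hq.ne']
  · rw [Finset.card_eq_zero, Finset.filter_eq_empty_iff]
    exact fun u _ hu => hm ⟨_, hu.symm⟩

lemma sum_card_minimalPeriod {n d m : ℕ} (hd : 0 < d) :
    ∑ ℓ ∈ d.divisors, (Finset.univ.filter fun w : Word n =>
        zeros w = m ∧ Function.minimalPeriod (rotWord n) w = ℓ).card
      = (Finset.univ.filter fun w : Word n =>
        zeros w = m ∧ Function.IsPeriodicPt (rotWord n) d w).card := by
  rw [Finset.card_eq_sum_card_fiberwise (f := Function.minimalPeriod (rotWord n))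
    (t := d.divisors)]
  · refine Finset.sum_congr rfl fun ℓ hℓ => ?_
    rw [Finset.filter_filter]
    congr 1
    refine Finset.filter_congr fun w _ => ?_
    rw [Function.isPeriodicPt_iff_minimalPeriod_dvd]
    have := Nat.dvd_of_mem_divisors hℓ
    constructor
    · rintro ⟨h1, rfl⟩
      exact ⟨⟨h1, this⟩, rfl⟩
    · exact fun h => ⟨h.1.1, h.2⟩
  · intro w hw
    simp only [Finset.coe_filter, Finset.mem_univ, true_and, Set.mem_ofPred_eq] at hw
    exact Nat.mem_divisors.mpr ⟨hw.2.minimalPeriod_dvd, hd.ne'⟩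

lemma card_minimalPeriod {n ℓ m : ℕ} (hn : 0 < n) (hℓ : ℓ ∣ n) (hm : n ∣ ℓ * m) :
    ((Finset.univ.filter fun w : Word n =>
        zeros w = m ∧ Function.minimalPeriod (rotWord n) w = ℓ).card : ℚ)
      = ∑ k ∈ (Nat.gcd ℓ (ℓ * m / n)).divisors,
        ((ArithmeticFunction.moebius k : ℤ) : ℚ) * ((ℓ / k).choose (ℓ * m / (k * n)) : ℚ) := by
  have hℓ0 : 0 < ℓ := Nat.pos_of_dvd_of_pos hℓ hn
  have h := ArithmeticFunction.sum_eq_iff_sum_mul_moebius_eq (R := ℚ)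
    (f := fun ℓ => ((Finset.univ.filter fun w : Word n =>
        zeros w = m ∧ Function.minimalPeriod (rotWord n) w = ℓ).card : ℚ))
    (g := fun d => ((Finset.univ.filter fun w : Word n =>
        zeros w = m ∧ Function.IsPeriodicPt (rotWord n) d w).card : ℚ))
  rw [← h.mp (fun d hd => by exact_mod_cast sum_card_minimalPeriod hd) ℓ hℓ0,
    Nat.sum_divisorsAntidiagonal fun k d =>
      ((ArithmeticFunction.moebius k : ℤ) : ℚ) * ((Finset.univ.filter fun w : Word n =>
        zeros w = m ∧ Function.IsPeriodicPt (rotWord n) d w).card : ℚ)]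
  symm
  refine Finset.sum_subset_zero_on_sdiff
    (Nat.divisors_subset_of_dvd hℓ0.ne' (Nat.gcd_dvd_left _ _)) ?_ ?_
  · intro k hk
    obtain ⟨hk1, hk2⟩ := Finset.mem_sdiff.mp hk
    obtain ⟨c, rfl⟩ := Nat.dvd_of_mem_divisors hk1
    have hk0 : 0 < k := Nat.pos_of_mul_pos_right hℓ0
    rw [Nat.mul_div_cancel_left _ hk0, card_isPeriodicPt hn ((Dvd.intro_left k rfl).trans hℓ),
      if_neg, Nat.cast_zero, mul_zero]
    rintro ⟨e, he⟩
    refine hk2 (Nat.mem_divisors.mpr ⟨Nat.dvd_gcd (Dvd.intro _ rfl) ?_,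
      (Nat.gcd_pos_of_pos_left _ hℓ0).ne'⟩)
    rw [mul_assoc, he, mul_left_comm, Nat.mul_div_cancel_left _ hn]
    exact Dvd.intro _ rfl
  · intro k hk
    have hk' := Nat.dvd_of_mem_divisors hk
    obtain ⟨c, rfl⟩ := hk'.trans (Nat.gcd_dvd_left _ _)
    have hk0 : 0 < k := Nat.pos_of_mul_pos_right hℓ0
    obtain ⟨e, he⟩ := hk'.trans (Nat.gcd_dvd_right _ _)
    have hcm : n * e = c * m := by
      have := Nat.div_mul_cancel hm
      rw [he] at this
      refine Nat.eq_of_mul_eq_mul_left hk0 ?_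
      rw [← mul_assoc k c, ← this]
      ring
    rw [Nat.mul_div_cancel_left _ hk0, card_isPeriodicPt hn ((Dvd.intro_left k rfl).trans hℓ),
      if_pos ⟨e, hcm.symm⟩, mul_assoc, Nat.mul_div_mul_left _ _ hk0]

lemma finrank_cycWeight_eq_S {n : ℕ} (hn : 0 < n) (m : ℕ) :
    (Module.finrank ℂ (cycWeight n m) : ℚ) = S n m := by
  have hper : ∀ w : Word n, Function.minimalPeriod (rotWord n) w ∈ n.divisors := by
    intro w
    refine Nat.mem_divisors.mpr ⟨Function.IsPeriodicPt.minimalPeriod_dvd ?_, hn.ne'⟩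
    rw [isPeriodicPt_rotWord_iff]
    intro i
    congr 1
    ext1
    rw [val_finRotate_iterate, Nat.add_mod_right, Nat.mod_eq_of_lt i.2]
  rw [finrank_cycWeight, S, ← Finset.sum_fiberwise_of_maps_to (t := n.divisors)
    (g := Function.minimalPeriod (rotWord n)) fun w _ => hper w]
  have hsum : ∀ ℓ ∈ n.divisors, (∑ w ∈ Finset.univ.filter fun w : Word n => zeros w = m with
        Function.minimalPeriod (rotWord n) w = ℓ,
        (1 - (1 : ℚ) / Function.minimalPeriod (rotWord n) w))
      = (((ℓ : ℚ) - 1) / ℓ) * (Finset.univ.filter fun w : Word n =>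
        zeros w = m ∧ Function.minimalPeriod (rotWord n) w = ℓ).card := by
    intro ℓ hℓ
    have hℓ0 : (ℓ : ℚ) ≠ 0 := Nat.cast_ne_zero.mpr (Nat.pos_of_mem_divisors hℓ).ne'
    rw [Finset.filter_filter, Finset.sum_congr rfl fun w hw => by
      rw [(Finset.mem_filter.mp hw).2.2], Finset.sum_const, nsmul_eq_mul, mul_comm, sub_div,
      div_self hℓ0]
  rw [Finset.sum_congr rfl hsum, Finset.sum_filter]
  refine Finset.sum_congr rfl fun ℓ hℓ => ?_
  have hℓn := Nat.dvd_of_mem_divisors hℓ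
  split_ifs with hm
  · rw [card_minimalPeriod hn hℓn hm]
  · have h0 := card_isPeriodicPt (m := m) hn hℓn
    rw [if_neg hm, Finset.card_eq_zero, Finset.filter_eq_empty_iff] at h0
    rw [Finset.card_eq_zero.mpr, Nat.cast_zero, mul_zero]
    rw [Finset.filter_eq_empty_iff]
    rintro w - ⟨h1, rfl⟩
    exact h0 (Finset.mem_univ w) ⟨h1, Function.isPeriodicPt_minimalPeriod _ _⟩

/-!
STATEMENT 8: for n ≥ 1 and 0 ≤ m with 2m ≤ n, the space of highest weight vectors
of weight n − 2m in Cₙ, namely {v ∈ Cₙ : H·v = (n − 2m)·v and E·v = 0}, has complex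
dimension S(n,m) − S(n,m−1), with the convention S(n,−1) := 0.
-/
theorem stmt_8 (n m : ℕ) (hn : 1 ≤ n) (hm : 2 * m ≤ n) :
    (Module.finrank ℂ
      ↥(Cyc n ⊓ LinearMap.ker (derivAction n Hmat - ((n : ℂ) - 2 * m) • LinearMap.id)
              ⊓ LinearMap.ker (derivAction n Emat)) : ℚ) =
    S n m - (if m = 0 then 0 else S n (m - 1)) := by
  rw [finrank_highestWeight]
  cases m with
  | zero => rw [finrank_cycWeight_inf_ker_zero, finrank_cycWeight_eq_S hn, if_pos rfl, sub_zero]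
  | succ m =>
    rw [if_neg (Nat.succ_ne_zero m), Nat.add_sub_cancel, ← finrank_cycWeight_eq_S hn,
      ← finrank_cycWeight_eq_S hn, ← finrank_cycWeight_inf_ker_succ (by omega : 2 * m < n),
      Nat.cast_add, add_sub_cancel_right]
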